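/- arXiv:math/0407421 — 3 statements merged into one kernel-verified Lean document; each statement's English description precedes it below -/
import Mathlib

section
/- Let d ≥ 1, h ≥ 1 and k ≥ 0 be integers with d even. Then ∑_{v | d^∞, ν_2(v) ≥ ν_2(h)+k} ∑_{α | d} μ(α)·gcd(αv,h)/(φ(dv)·α·v) = 4^{−k} · (1/(d·(h,d^∞))) · ∏_{p|d} p²/(p²−1). -/
open ArithmeticFunction
open scoped Classical

/-- For multiplicative `f`, the sum `∑ μ(a) f(a)` over the divisors of any `n ≠ 0` is an Euler
product. -/
lemma sum_divisors_moebius_mul (f : ArithmeticFunction ℝ) (hf : f.IsMultiplicative) {n : ℕ}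
    (hn : n ≠ 0) :
    ∑ a ∈ n.divisors, (moebius a : ℝ) * f a = ∏ p ∈ n.primeFactors, (1 - f p) := by
  set r := ∏ p ∈ n.primeFactors, p with hr
  have hrn : r ∣ n := Nat.prod_primeFactors_dvd n
  have hr0 : r ≠ 0 := ne_zero_of_dvd_ne_zero hn hrn
  have hrp : r.primeFactors = n.primeFactors :=
    Nat.primeFactors_prod fun p hp => Nat.prime_of_mem_primeFactors hp
  have hrs : Squarefree r := by
    refine Finset.squarefree_prod_of_pairwise_isCoprime ?_ ?_
    · intro p hp q hq hpq
      exact Nat.coprime_iff_isRelPrime.mp ((Nat.coprime_primes (Nat.prime_of_mem_primeFactors hp)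
        (Nat.prime_of_mem_primeFactors hq)).2 hpq)
    · exact fun p hp => (Nat.prime_of_mem_primeFactors hp).prime.squarefree
  rw [← hrp, hf.prodPrimeFactors_one_sub_of_squarefree f hrs]
  symm
  apply Finset.sum_subset (Nat.divisors_subset_of_dvd hn hrn)
  intro a ha har
  rw [moebius_eq_zero_of_not_squarefree, Int.cast_zero, zero_mul]
  intro hsq
  apply har
  rw [Nat.mem_divisors] at ha ⊢
  refine ⟨?_, hr0⟩
  rw [← Nat.prod_primeFactors_of_squarefree hsq]
  exact Finset.prod_dvd_prod_of_subset _ _ _ (Nat.primeFactors_mono ha.1 hn)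

lemma gcd_mul_eq_gcd_mul_gcd_div (a v : ℕ) {h : ℕ} (hh : 0 < h) :
    Nat.gcd (a * v) h = Nat.gcd v h * Nat.gcd a (h / Nat.gcd v h) := by
  have hg : 0 < Nat.gcd v h := Nat.gcd_pos_of_pos_right v hh
  have hcop := Nat.coprime_div_gcd_div_gcd hg
  set g := Nat.gcd v h
  obtain ⟨v', hv⟩ : g ∣ v := Nat.gcd_dvd_left v h
  obtain ⟨h', hh'⟩ : g ∣ h := Nat.gcd_dvd_right v h
  rw [hv, hh', Nat.mul_div_cancel_left _ hg, Nat.mul_div_cancel_left _ hg] at hcop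
  rw [hv, hh', Nat.mul_div_cancel_left _ hg, mul_left_comm, Nat.gcd_mul_left,
    Nat.Coprime.gcd_mul_right_cancel _ hcop]

/-- The multiplicative function `a ↦ gcd(a, m) / a`. -/
noncomputable def gcdDivSelf (m : ℕ) : ArithmeticFunction ℝ :=
  ⟨fun a => (Nat.gcd a m : ℝ) / a, by simp⟩

lemma gcdDivSelf_apply (m a : ℕ) : gcdDivSelf m a = (Nat.gcd a m : ℝ) / a := rfl

lemma isMultiplicative_gcdDivSelf (m : ℕ) : (gcdDivSelf m).IsMultiplicative := by
  refine ⟨by simp [gcdDivSelf_apply], fun {a b} hab => ?_⟩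
  simp only [gcdDivSelf_apply]
  rw [Nat.gcd_comm (a * b), Nat.Coprime.gcd_mul m hab, Nat.gcd_comm m, Nat.gcd_comm m,
    div_mul_div_comm]
  push_cast
  rfl

lemma sum_divisors_moebius_gcd {d h : ℕ} (v : ℕ) (hd : d ≠ 0) (hh : 0 < h) :
    ∑ a ∈ d.divisors, (moebius a : ℝ) * Nat.gcd (a * v) h / (Nat.totient (d * v) * a * v) =
      (Nat.gcd v h : ℝ) / (Nat.totient (d * v) * v) *
        ∏ p ∈ d.primeFactors, (1 - (Nat.gcd p (h / Nat.gcd v h) : ℝ) / p) := by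
  rw [← Finset.prod_congr rfl fun p _ => congrArg (1 - ·) (gcdDivSelf_apply _ p),
    ← sum_divisors_moebius_mul _ (isMultiplicative_gcdDivSelf _) hd, Finset.mul_sum]
  refine Finset.sum_congr rfl fun a _ => ?_
  rw [gcd_mul_eq_gcd_mul_gcd_div a v hh, gcdDivSelf_apply]
  push_cast
  simp only [div_eq_mul_inv, mul_inv]
  ring

lemma prod_prime_pow_dvd_iff {s : Finset ℕ} (hs : ∀ p ∈ s, p.Prime) (e : ℕ → ℕ) {v : ℕ}
    (hv : v ≠ 0) : ∏ p ∈ s, p ^ e p ∣ v ↔ ∀ p ∈ s, e p ≤ v.factorization p := by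
  constructor
  · intro H p hp
    exact ((hs p hp).pow_dvd_iff_le_factorization hv).1
      ((Finset.dvd_prod_of_mem (fun p => p ^ e p) hp).trans H)
  · intro H
    refine Finset.prod_dvd_of_isRelPrime ?_ fun p hp =>
      ((hs p hp).pow_dvd_iff_le_factorization hv).2 (H p hp)
    intro p hp q hq hpq
    exact Nat.coprime_iff_isRelPrime.mp
      (Nat.Coprime.pow _ _ ((Nat.coprime_primes (hs p hp) (hs q hq)).2 hpq))

/-- The inner sum vanishes unless the `d`-part of `h` divides `v`. -/
lemma sum_divisors_moebius_gcd_eq {d h v : ℕ} (hd : d ≠ 0) (hh : 0 < h)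
    (hv : v ∈ Nat.factoredNumbers d.primeFactors) :
    ∑ a ∈ d.divisors, (moebius a : ℝ) * Nat.gcd (a * v) h / (Nat.totient (d * v) * a * v) =
      if ∏ p ∈ d.primeFactors, p ^ h.factorization p ∣ v then
        (∏ p ∈ d.primeFactors, (p : ℝ) ^ h.factorization p) / (d * (v : ℝ) ^ 2) else 0 := by
  have hprime : ∀ p ∈ d.primeFactors, p.Prime := fun p hp => Nat.prime_of_mem_primeFactors hp
  have hv0 : v ≠ 0 := Nat.ne_zero_of_mem_factoredNumbers hv
  have hvd : v.primeFactors ⊆ d.primeFactors :=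
    Nat.primeFactors_subset_of_mem_factoredNumbers hv
  have hg0 : Nat.gcd v h ≠ 0 := (Nat.gcd_pos_of_pos_right v hh).ne'
  have hgh : Nat.gcd v h ∣ h := Nat.gcd_dvd_right v h
  rw [sum_divisors_moebius_gcd v hd hh]
  have hfac (p : ℕ) : (h / Nat.gcd v h).factorization p =
      h.factorization p - (Nat.gcd v h).factorization p := by
    rw [Nat.factorization_div hgh]; rfl
  have hq0 : h / Nat.gcd v h ≠ 0 := (Nat.div_pos (Nat.le_of_dvd hh hgh) (by omega)).ne'
  split_ifs with hM
  · have hMg : ∏ p ∈ d.primeFactors, p ^ h.factorization p ∣ Nat.gcd v h :=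
      Nat.dvd_gcd hM ((prod_prime_pow_dvd_iff hprime _ hh.ne').2 fun _ _ => le_rfl)
    have hM0 : ∏ p ∈ d.primeFactors, p ^ h.factorization p ≠ 0 := ne_zero_of_dvd_ne_zero hv0 hM
    have hgM : Nat.gcd v h = ∏ p ∈ d.primeFactors, p ^ h.factorization p := by
      refine Nat.dvd_antisymm ((Nat.factorization_prime_le_iff_dvd hg0 hM0).1 fun p hp => ?_) hMg
      by_cases hpd : p ∈ d.primeFactors
      · exact ((Nat.factorization_le_iff_dvd hg0 hh.ne').2 hgh p).trans
          ((prod_prime_pow_dvd_iff hprime _ hM0).1 dvd_rfl p hpd)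
      · have hvp : v.factorization p = 0 :=
          Finsupp.notMem_support_iff.1 fun hpv => hpd (hvd hpv)
        have := (Nat.factorization_le_iff_dvd hg0 hv0).2 (Nat.gcd_dvd_left v h) p
        omega
    have hgcd (p : ℕ) (hp : p ∈ d.primeFactors) : Nat.gcd p (h / Nat.gcd v h) = 1 := by
      rw [← Nat.coprime_iff_gcd_eq_one, (hprime p hp).coprime_iff_not_dvd,
        (hprime p hp).dvd_iff_one_le_factorization hq0, hfac]
      have := (prod_prime_pow_dvd_iff hprime _ hg0).1 hMg p hp
      omega
    have hpf : (d * v).primeFactors = d.primeFactors := by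
      rw [Nat.primeFactors_mul hd hv0, Finset.union_eq_left.2 hvd]
    have htot : (Nat.totient (d * v) : ℝ) =
        d * v * ∏ p ∈ d.primeFactors, (1 - (p : ℝ)⁻¹) := by
      have := congrArg (Rat.cast : ℚ → ℝ) (Nat.totient_eq_mul_prod_factors (d * v))
      rw [hpf] at this
      push_cast at this
      exact this
    have hpos : ∏ p ∈ d.primeFactors, (1 - (p : ℝ)⁻¹) ≠ 0 := by
      refine Finset.prod_ne_zero_iff.2 fun p hp => sub_ne_zero.2 fun h1 => ?_
      exact (hprime p hp).ne_one (by exact_mod_cast (inv_eq_one.1 h1.symm))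
    rw [Finset.prod_congr rfl fun p hp => by
      rw [hgcd p hp, Nat.cast_one, one_div], htot, hgM]
    have : (v : ℝ) ≠ 0 := by exact_mod_cast hv0
    have : (d : ℝ) ≠ 0 := by exact_mod_cast hd
    push_cast
    generalize ∏ p ∈ d.primeFactors, (1 - (p : ℝ)⁻¹) = P at hpos ⊢
    field_simp
  · rw [prod_prime_pow_dvd_iff hprime _ hv0] at hM
    push Not at hM
    obtain ⟨p, hp, hlt⟩ := hM
    have hdvd : p ∣ h / Nat.gcd v h := by
      rw [(hprime p hp).dvd_iff_one_le_factorization hq0, hfac]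
      have := (Nat.factorization_le_iff_dvd hg0 hv0).2 (Nat.gcd_dvd_left v h) p
      omega
    refine mul_eq_zero_of_right _ (Finset.prod_eq_zero hp ?_)
    have : (p : ℝ) ≠ 0 := by exact_mod_cast (hprime p hp).ne_zero
    rw [Nat.gcd_eq_left hdvd, div_self this, sub_self]

lemma tsum_factoredNumbers_inv_sq (n : ℕ) :
    ∑' w : Nat.factoredNumbers n.primeFactors, ((w : ℕ) ^ 2 : ℝ)⁻¹ =
      ∏ p ∈ n.primeFactors, (p : ℝ) ^ 2 / ((p : ℝ) ^ 2 - 1) := by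
  let f : ℕ →* ℝ :=
    { toFun := fun w => ((w : ℝ) ^ 2)⁻¹
      map_one' := by simp
      map_mul' := fun a b => by push_cast; rw [mul_pow, mul_inv] }
  have hf : Summable f := Real.summable_nat_pow_inv.2 one_lt_two
  refine (EulerProduct.prod_filter_prime_geometric_eq_tsum_factoredNumbers hf
    n.primeFactors).symm.trans ?_
  rw [Finset.filter_true_of_mem fun p hp => Nat.prime_of_mem_primeFactors hp]
  refine Finset.prod_congr rfl fun p hp => ?_
  have hp1 : (1 : ℝ) < p := by exact_mod_cast (Nat.prime_of_mem_primeFactors hp).one_lt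
  have h1 : (p : ℝ) ^ 2 - 1 ≠ 0 := by nlinarith
  change (1 - ((p : ℝ) ^ 2)⁻¹)⁻¹ = _
  rw [← inv_div]
  congr 1
  field_simp

lemma tsum_factoredNumbers_multiples {n m : ℕ} (hm : m ∈ Nat.factoredNumbers n.primeFactors)
    (c : ℝ) :
    (∑' v : ℕ, if v ∈ Nat.factoredNumbers n.primeFactors ∧ m ∣ v then
        c / (v : ℝ) ^ 2 else 0) =
      c / (m : ℝ) ^ 2 * ∏ p ∈ n.primeFactors, (p : ℝ) ^ 2 / ((p : ℝ) ^ 2 - 1) := by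
  have hm0 : m ≠ 0 := Nat.ne_zero_of_mem_factoredNumbers hm
  rw [← (mul_right_injective₀ hm0).tsum_eq, ← tsum_factoredNumbers_inv_sq, ← tsum_mul_left,
    tsum_subtype (Nat.factoredNumbers n.primeFactors)
      fun w : ℕ => c / (m : ℝ) ^ 2 * ((w : ℝ) ^ 2)⁻¹]
  · refine tsum_congr fun w => ?_
    have hiff : m * w ∈ Nat.factoredNumbers n.primeFactors ↔
        w ∈ Nat.factoredNumbers n.primeFactors := by
      refine ⟨fun hmw => Nat.mem_factoredNumbers_of_dvd hmw (dvd_mul_left w m),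
        fun hw => Nat.mul_mem_factoredNumbers hm hw⟩
    simp only [hiff, dvd_mul_right, and_true, Set.indicator_apply]
    refine if_congr Iff.rfl ?_ rfl
    push_cast
    rw [mul_pow, ← div_div, div_eq_mul_inv _ ((w : ℝ) ^ 2)]
  · intro v hv
    rw [Function.mem_support, ne_eq, ite_eq_right_iff, Classical.not_imp] at hv
    obtain ⟨w, rfl⟩ := hv.1.2
    exact ⟨w, rfl⟩

theorem double_sum_eval_shifted (d h k : ℕ) (hd : 1 ≤ d) (hh : 1 ≤ h) (heven : 2 ∣ d) :
    (∑' v : ℕ, if 0 < v ∧ (∀ q : ℕ, q.Prime → q ∣ v → q ∣ d) ∧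
          h.factorization 2 + k ≤ v.factorization 2 then
        ∑ α ∈ d.divisors, (moebius α : ℝ) * Nat.gcd (α * v) h /
          (Nat.totient (d * v) * α * v)
      else 0)
    = (4 : ℝ)⁻¹ ^ k * ((1 / ((d : ℝ) * ∏ p ∈ d.primeFactors, (p : ℝ) ^ (h.factorization p))) *
        ∏ p ∈ d.primeFactors, (p : ℝ) ^ 2 / ((p : ℝ) ^ 2 - 1)) := by
  have hd0 : d ≠ 0 := by omega
  have hprime : ∀ p ∈ d.primeFactors, p.Prime := fun p hp => Nat.prime_of_mem_primeFactors hp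
  have h2 : 2 ∈ d.primeFactors := Nat.mem_primeFactors.2 ⟨Nat.prime_two, heven, hd0⟩
  have hmem (v : ℕ) : v ∈ Nat.factoredNumbers d.primeFactors ↔
      0 < v ∧ ∀ q : ℕ, q.Prime → q ∣ v → q ∣ d := by
    rw [Nat.mem_factoredNumbers_iff_primeFactors_subset, Nat.pos_iff_ne_zero]
    refine and_congr_right fun hv => ⟨fun H q hq hqv => ?_, fun H q hq => ?_⟩
    · exact Nat.dvd_of_mem_primeFactors (H (Nat.mem_primeFactors.2 ⟨hq, hqv, hv⟩))
    · have hq' := Nat.mem_primeFactors.1 hq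
      exact Nat.mem_primeFactors.2 ⟨hq'.1, H q hq'.1 hq'.2.1, hd0⟩
  set M := ∏ p ∈ d.primeFactors, p ^ h.factorization p with hM
  have hMR : ∏ p ∈ d.primeFactors, (p : ℝ) ^ h.factorization p = M := by
    rw [hM]; push_cast; rfl
  have hMk : M * 2 ^ k =
      ∏ p ∈ d.primeFactors, p ^ (h.factorization p + if p = 2 then k else 0) := by
    simp only [pow_add, Finset.prod_mul_distrib, pow_ite, pow_zero]
    rw [Finset.prod_ite_eq' d.primeFactors 2 (fun p => p ^ k), if_pos h2]
  have hdvd {v : ℕ} (hv : v ≠ 0) :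
      M * 2 ^ k ∣ v ↔ h.factorization 2 + k ≤ v.factorization 2 ∧ M ∣ v := by
    rw [hMk, hM, prod_prime_pow_dvd_iff hprime _ hv, prod_prime_pow_dvd_iff hprime _ hv]
    constructor
    · intro H
      exact ⟨by simpa using H 2 h2, fun p hp => (Nat.le_add_right _ _).trans (H p hp)⟩
    · rintro ⟨H2, H⟩ p hp
      split_ifs with hp2
      · exact hp2 ▸ H2
      · exact H p hp
  have hM0 : M ≠ 0 := Finset.prod_ne_zero_iff.2 fun p hp => pow_ne_zero _ (hprime p hp).ne_zero
  have hmf : M * 2 ^ k ∈ Nat.factoredNumbers d.primeFactors := by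
    refine (hmem _).2 ⟨by positivity, fun q hq hqm => ?_⟩
    rw [hMk, hq.prime.dvd_finsetProd_iff] at hqm
    obtain ⟨p, hp, hqp⟩ := hqm
    rw [(Nat.prime_dvd_prime_iff_eq hq (hprime p hp)).1 (hq.dvd_of_dvd_pow hqp)]
    exact Nat.dvd_of_mem_primeFactors hp
  trans ∑' v : ℕ, if v ∈ Nat.factoredNumbers d.primeFactors ∧ M * 2 ^ k ∣ v then
        ((M : ℝ) / d) / (v : ℝ) ^ 2 else 0
  · refine tsum_congr fun v => ?_
    simp only [← and_assoc, ← hmem]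
    by_cases hv : v ∈ Nat.factoredNumbers d.primeFactors
    · rw [sum_divisors_moebius_gcd_eq hd0 hh hv, hMR, ← hM, div_div,
        ← ite_and]
      refine if_congr ?_ rfl rfl
      rw [hdvd (Nat.ne_zero_of_mem_factoredNumbers hv), and_assoc]
    · simp [hv]
  · rw [tsum_factoredNumbers_multiples hmf, hMR, ← mul_assoc]
    congr 1
    have : (M : ℝ) ≠ 0 := by exact_mod_cast hM0
    have : (d : ℝ) ≠ 0 := by exact_mod_cast hd0
    have h4 : (4 : ℝ) ^ k = (2 ^ k) ^ 2 := by rw [← pow_mul, mul_comm, pow_mul]; norm_num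
    rw [inv_pow, h4]
    push_cast
    field_simp
end

section
/- Let d ≥ 1, h ≥ 1 be integers and D a fundamental discriminant with D | 4d and 2 | d, and set γ = max{0, ν_2(D/(dh))} (interpreting ν_2(D/dh) as ν_2(D)−ν_2(d)−ν_2(h)). If γ ≥ 1, then ∑_{v | d^∞, [2^{ν_2(hd/α)+1}, D] | dv} ∑_{α | d} μ(α)·gcd(αv,h)/(φ(dv)·α·v) = 4^{−γ}·S(d,h), where S(d,h) = (1/(d(h,d^∞)))∏_{p|d} p²/(p²−1). -/
open ArithmeticFunction
open scoped Classical

/-- `D` is a fundamental discriminant (the discriminant of a quadratic field):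
either `D ≡ 1 (mod 4)` and squarefree, or `D = 4m` with `m` squarefree and
`m ≡ 2, 3 (mod 4)`. -/
def IsFundamentalDiscriminant (D : ℤ) : Prop :=
  (D % 4 = 1 ∧ Squarefree D) ∨
  (∃ m : ℤ, D = 4 * m ∧ Squarefree m ∧ (m % 4 = 2 ∨ m % 4 = 3))

open Finset in
lemma prod_primes_pow_dvd_iff {S : Finset ℕ} (hS : ∀ p ∈ S, p.Prime) (e : ℕ → ℕ) (n : ℕ) :
    (∏ p ∈ S, p ^ e p) ∣ n ↔ ∀ p ∈ S, p ^ e p ∣ n := by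
  refine ⟨fun h p hp => (dvd_prod_of_mem _ hp).trans h, fun h => ?_⟩
  induction S using Finset.induction_on with
  | empty => simp
  | insert p S hpS ih =>
    rw [prod_insert hpS]
    refine Nat.Coprime.mul_dvd_of_dvd_of_dvd (Nat.Coprime.prod_right fun q hq => ?_)
      (h p (mem_insert_self p S))
      (ih (fun q hq => hS q (mem_insert_of_mem hq)) fun q hq => h q (mem_insert_of_mem hq))
    exact Nat.Coprime.pow _ _ ((Nat.coprime_primes (hS p (mem_insert_self p S))
      (hS q (mem_insert_of_mem hq))).2 (by rintro rfl; exact hpS hq))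

lemma sum_moebius_div_divisors {d : ℕ} (hd : d ≠ 0) :
    ∑ α ∈ d.divisors, (moebius α : ℝ) / α = Nat.totient d / d := by
  have h := (sum_eq_iff_sum_mul_moebius_eq (R := ℝ) (f := fun n => (Nat.totient n : ℝ))
    (g := fun n => (n : ℝ))).1 (fun n _ => by exact_mod_cast Nat.sum_totient n) d
      (Nat.pos_of_ne_zero hd)
  rw [← h, Finset.sum_div, Nat.sum_divisorsAntidiagonal
    (f := fun a b => (moebius a : ℝ) * (b : ℝ) / d)]
  refine Finset.sum_congr rfl fun α hα => ?_
  have hαd := Nat.dvd_of_mem_divisors hα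
  have hα0 : (α : ℝ) ≠ 0 := by exact_mod_cast ne_zero_of_dvd_ne_zero hd hαd
  have hd' : (d : ℝ) ≠ 0 := by exact_mod_cast hd
  rw [Nat.cast_div hαd hα0]
  field_simp

lemma gcd_mul_eq_prod_of_mem_factoredNumbers {d h v α : ℕ} (hh : h ≠ 0) (hα : α ∣ d)
    (hd : d ≠ 0) (hv : v ∈ Nat.factoredNumbers d.primeFactors)
    (hHv : (∏ p ∈ d.primeFactors, p ^ h.factorization p) ∣ v) :
    Nat.gcd (α * v) h = ∏ p ∈ d.primeFactors, p ^ h.factorization p := by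
  apply Nat.dvd_antisymm
  · rw [Nat.dvd_iff_prime_pow_dvd_dvd]
    intro q k hq hk
    rcases Nat.eq_zero_or_pos k with rfl | hk0
    · simp
    have hqd : q ∈ d.primeFactors := by
      have hqv : q ∣ α * v :=
        (dvd_pow_self q hk0.ne').trans (hk.trans (Nat.gcd_dvd_left _ _))
      rcases hq.dvd_mul.1 hqv with h1 | h1
      · exact Nat.mem_primeFactors.2 ⟨hq, h1.trans hα, hd⟩
      · exact Nat.mem_factoredNumbers'.1 hv q hq h1
    refine dvd_trans (pow_dvd_pow q ?_) (Finset.dvd_prod_of_mem _ hqd)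
    exact (hq.pow_dvd_iff_le_factorization hh).1 (hk.trans (Nat.gcd_dvd_right _ _))
  · refine Nat.dvd_gcd (hHv.mul_left α) ?_
    exact (prod_primes_pow_dvd_iff (fun p hp => Nat.prime_of_mem_primeFactors hp) _ _).2
      fun p _ => Nat.ordProj_dvd h p

lemma gcd_prime_mul_eq_of_factorization_lt {p n h : ℕ} (hp : p.Prime) (hn : n ≠ 0) (hh : h ≠ 0)
    (hlt : n.factorization p < h.factorization p) :
    Nat.gcd (p * n) h = p * Nat.gcd n h := by
  have hpn : p * n ≠ 0 := mul_ne_zero hp.ne_zero hn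
  have hg : Nat.gcd n h ≠ 0 := Nat.gcd_ne_zero_right hh
  apply Nat.eq_of_factorization_eq (Nat.gcd_ne_zero_right hh) (mul_ne_zero hp.ne_zero hg)
  intro q
  rw [Nat.factorization_gcd hpn hh, Nat.factorization_mul hp.ne_zero hg,
    Nat.factorization_mul hp.ne_zero hn, Nat.factorization_gcd hn hh]
  simp only [Finsupp.inf_apply, Finsupp.add_apply, hp.factorization, Finsupp.single_apply]
  split_ifs with hpq
  · subst hpq; omega
  · simp

lemma sum_moebius_mul_gcd_div_eq_zero {d h v p : ℕ} (hd : d ≠ 0) (hh : h ≠ 0) (hv : v ≠ 0)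
    (hp : p.Prime) (hpd : p ∣ d) (hlt : v.factorization p < h.factorization p) :
    ∑ α ∈ d.divisors, (moebius α : ℝ) * Nat.gcd (α * v) h / α = 0 := by
  have hsq : ∑ α ∈ d.divisors with Squarefree α, (moebius α : ℝ) * Nat.gcd (α * v) h / α =
      ∑ α ∈ d.divisors, (moebius α : ℝ) * Nat.gcd (α * v) h / α := by
    refine Finset.sum_filter_of_ne fun α _ hne => ?_
    by_contra hα
    simp [moebius_eq_zero_of_not_squarefree hα] at hne
  have key : ∀ β : ℕ, β ≠ 0 → ¬ p ∣ β →
      (moebius (p * β) : ℝ) * Nat.gcd (p * β * v) h / (p * β : ℕ) =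
        -((moebius β : ℝ) * Nat.gcd (β * v) h / β) := by
    intro β hβ hpβ
    have h1 : moebius (p * β) = - moebius β := by
      rw [isMultiplicative_moebius.map_mul_of_coprime ((hp.coprime_iff_not_dvd).2 hpβ),
        moebius_apply_prime hp, neg_one_mul]
    have h2 : Nat.gcd (p * β * v) h = p * Nat.gcd (β * v) h := by
      rw [mul_assoc]
      refine gcd_prime_mul_eq_of_factorization_lt hp (mul_ne_zero hβ hv) hh ?_
      rw [Nat.factorization_mul hβ hv, Finsupp.add_apply,
        Nat.factorization_eq_zero_of_not_dvd hpβ, zero_add]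
      exact hlt
    have hp0 : (p : ℝ) ≠ 0 := by exact_mod_cast hp.ne_zero
    have hβ0 : (β : ℝ) ≠ 0 := by exact_mod_cast hβ
    rw [h1, h2]
    push_cast
    field_simp
  have hdvd : ∀ {α}, Squarefree α → p ∣ α → ¬ p ∣ α / p := by
    rintro _ hα ⟨β, rfl⟩ hpβ
    rw [Nat.mul_div_cancel_left _ hp.pos] at hpβ
    exact hp.one_lt.ne' (Nat.isUnit_iff.1 (hα p (mul_dvd_mul_left p hpβ)))
  rw [← hsq]
  refine Finset.sum_involution (fun α _ => if p ∣ α then α / p else p * α) ?_ ?_ ?_ ?_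
  · intro α hα
    simp only [Finset.mem_filter, Nat.mem_divisors] at hα
    have hα0 := ne_zero_of_dvd_ne_zero hd hα.1.1
    split_ifs with hpα
    · have hnd := hdvd hα.2 hpα
      obtain ⟨β, rfl⟩ := hpα
      rw [Nat.mul_div_cancel_left _ hp.pos] at hnd ⊢
      rw [key β (right_ne_zero_of_mul hα0) hnd]
      ring
    · rw [key α hα0 hpα]
      ring
  · intro α hα _
    simp only [Finset.mem_filter, Nat.mem_divisors] at hα
    have hα0 := ne_zero_of_dvd_ne_zero hd hα.1.1
    split_ifs with hpα
    · exact (Nat.div_lt_self (Nat.pos_of_ne_zero hα0) hp.one_lt).ne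
    · intro heq
      exact hpα ⟨α, heq.symm⟩
  · intro α hα
    simp only [Finset.mem_filter, Nat.mem_divisors] at hα ⊢
    split_ifs with hpα
    · have := Nat.div_dvd_of_dvd hpα
      exact ⟨⟨this.trans hα.1.1, hd⟩, hα.2.squarefree_of_dvd this⟩
    · have hc := (hp.coprime_iff_not_dvd).2 hpα
      exact ⟨⟨hc.mul_dvd_of_dvd_of_dvd hpd hα.1.1, hd⟩,
        (Nat.squarefree_mul hc).2 ⟨hp.prime.squarefree, hα.2⟩⟩
  · intro α hα
    simp only [Finset.mem_filter, Nat.mem_divisors] at hα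
    by_cases hpα : p ∣ α
    · simp only [hpα, if_true, hdvd hα.2 hpα, if_false]
      exact Nat.mul_div_cancel' hpα
    · simp [hpα, hp.pos]

lemma sum_moebius_mul_gcd_div {d h v : ℕ} (hd : d ≠ 0) (hh : h ≠ 0)
    (hv : v ∈ Nat.factoredNumbers d.primeFactors) :
    ∑ α ∈ d.divisors, (moebius α : ℝ) * Nat.gcd (α * v) h / α =
      if (∏ p ∈ d.primeFactors, p ^ h.factorization p) ∣ v then
        (∏ p ∈ d.primeFactors, p ^ h.factorization p : ℕ) * (Nat.totient d / d : ℝ) else 0 := by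
  have hv0 := Nat.ne_zero_of_mem_factoredNumbers hv
  split_ifs with hH
  · rw [← sum_moebius_div_divisors hd, Finset.mul_sum]
    refine Finset.sum_congr rfl fun α hα => ?_
    rw [gcd_mul_eq_prod_of_mem_factoredNumbers hh (Nat.dvd_of_mem_divisors hα) hd hv hH]
    ring
  · rw [prod_primes_pow_dvd_iff fun p hp => Nat.prime_of_mem_primeFactors hp] at hH
    push Not at hH
    obtain ⟨p, hp, hpv⟩ := hH
    have hpp := Nat.prime_of_mem_primeFactors hp
    rw [hpp.pow_dvd_iff_le_factorization hv0, not_le] at hpv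
    exact sum_moebius_mul_gcd_div_eq_zero hd hh hv0 hpp (Nat.dvd_of_mem_primeFactors hp) hpv

lemma totient_mul_of_mem_factoredNumbers {d v : ℕ} (hd : d ≠ 0)
    (hv : v ∈ Nat.factoredNumbers d.primeFactors) :
    Nat.totient (d * v) = Nat.totient d * v := by
  have hv0 := Nat.ne_zero_of_mem_factoredNumbers hv
  have hpf : (d * v).primeFactors = d.primeFactors := by
    rw [Nat.primeFactors_mul hd hv0]
    exact Finset.union_eq_left.2 (Nat.primeFactors_subset_of_mem_factoredNumbers hv)
  have h : (Nat.totient (d * v) : ℚ) = Nat.totient d * v := by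
    rw [Nat.totient_eq_mul_prod_factors, Nat.totient_eq_mul_prod_factors d, hpf]
    push_cast
    ring
  exact_mod_cast h

lemma tsum_factoredNumbers_dvd_inv_sq {S : Finset ℕ} (hS : ∀ p ∈ S, p.Prime) {M : ℕ}
    (hM : M ∈ Nat.factoredNumbers S) :
    ∑' v : ℕ, (if v ∈ Nat.factoredNumbers S ∧ M ∣ v then ((v : ℝ) ^ 2)⁻¹ else 0) =
      ((M : ℝ) ^ 2)⁻¹ * ∏ p ∈ S, (p : ℝ) ^ 2 / ((p : ℝ) ^ 2 - 1) := by
  have hM0 := Nat.ne_zero_of_mem_factoredNumbers hM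
  have hinj : Function.Injective fun w : ℕ => M * w :=
    fun a b hab => Nat.eq_of_mul_eq_mul_left (Nat.pos_of_ne_zero hM0) hab
  rw [← hinj.tsum_eq]
  swap
  · intro v hv
    by_contra hne
    refine hv (if_neg ?_)
    rintro ⟨-, w, rfl⟩
    exact hne ⟨w, rfl⟩
  let f : ℕ →* ℝ :=
    { toFun := fun n => ((n : ℝ) ^ 2)⁻¹
      map_one' := by simp
      map_mul' := fun a b => by push_cast; rw [mul_pow, mul_inv] }
  have hf : Summable f := Real.summable_nat_pow_inv.2 (by norm_num)
  have heuler := EulerProduct.prod_filter_prime_geometric_eq_tsum_factoredNumbers hf S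
  rw [Finset.filter_true_of_mem hS, tsum_subtype (Nat.factoredNumbers S) f] at heuler
  have hprod : ∏ p ∈ S, (p : ℝ) ^ 2 / ((p : ℝ) ^ 2 - 1) = ∏ p ∈ S, (1 - f p)⁻¹ := by
    refine Finset.prod_congr rfl fun p hp => ?_
    have hp1 : (1 : ℝ) < p := by exact_mod_cast (hS p hp).one_lt
    have h1 : (p : ℝ) ^ 2 - 1 ≠ 0 := by nlinarith
    have h2 : (p : ℝ) ^ 2 ≠ 0 := by positivity
    change _ = (1 - ((p : ℝ) ^ 2)⁻¹)⁻¹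
    rw [← one_div_div, one_div, sub_div, div_self h2, one_div]
  rw [hprod, heuler, ← tsum_mul_left]
  refine tsum_congr fun w => ?_
  have hiff : M * w ∈ Nat.factoredNumbers S ↔ w ∈ Nat.factoredNumbers S :=
    ⟨fun h => Nat.mem_factoredNumbers_of_dvd h (dvd_mul_left w M),
      fun h => Nat.mul_mem_factoredNumbers hM h⟩
  simp only [hiff, dvd_mul_right, and_true, Set.indicator_apply]
  split_ifs
  · change _ = _ * ((w : ℝ) ^ 2)⁻¹
    push_cast
    rw [mul_pow, mul_inv]
  · simp

lemma dvd_mul_iff_two_factorization_le {d v n : ℕ} (hd : d ≠ 0) (hv : v ≠ 0) (hn : n ≠ 0)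
    (hnd : n ∣ 4 * d) :
    n ∣ d * v ↔ n.factorization 2 ≤ d.factorization 2 + v.factorization 2 := by
  rw [← Nat.factorization_le_iff_dvd hn (mul_ne_zero hd hv), Nat.factorization_mul hd hv]
  refine ⟨fun h => h 2, fun h p => ?_⟩
  rcases eq_or_ne p 2 with rfl | hp
  · exact h
  · have h4 := (Nat.factorization_le_iff_dvd hn (by positivity)).2 hnd p
    have h22 : (4 : ℕ) = 2 ^ 2 := by norm_num
    rw [Nat.factorization_mul (by norm_num) hd, h22, Nat.prime_two.factorization_pow,
      Finsupp.add_apply, Finsupp.single_eq_of_ne hp, zero_add] at h4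
    exact h4.trans (Nat.le_add_right _ _)

lemma lcm_two_pow_dvd_mul_iff {d h v n α : ℕ} (hd : d ≠ 0) (hh : h ≠ 0) (hv : v ≠ 0)
    (hn : n ≠ 0) (hnd : n ∣ 4 * d) (hα : α ∣ d)
    (hlt : d.factorization 2 + h.factorization 2 < n.factorization 2) :
    Nat.lcm (2 ^ ((h * d / α).factorization 2 + 1)) n ∣ d * v ↔
      n.factorization 2 ≤ d.factorization 2 + v.factorization 2 := by
  rw [Nat.lcm_dvd_iff, dvd_mul_iff_two_factorization_le hd hv hn hnd]
  refine and_iff_right_of_imp fun hle => ?_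
  rw [Nat.prime_two.pow_dvd_iff_le_factorization (mul_ne_zero hd hv),
    Nat.factorization_mul hd hv, Finsupp.add_apply]
  have hhd : h * d ≠ 0 := mul_ne_zero hh hd
  have hdvd : h * d / α ∣ h * d := Nat.div_dvd_of_dvd (hα.mul_left h)
  have := (Nat.factorization_le_iff_dvd (ne_zero_of_dvd_ne_zero hhd hdvd) hhd).2 hdvd 2
  rw [Nat.factorization_mul hh hd, Finsupp.add_apply] at this
  omega

theorem S3_eval_pos_gamma (d h : ℕ) (hd : 1 ≤ d) (hh : 1 ≤ h) (D : ℤ)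
    (hD : IsFundamentalDiscriminant D) (hDd : D ∣ 4 * (d : ℤ)) (h2d : 2 ∣ d)
    (γ : ℤ)
    (hγ : γ = max 0 ((D.natAbs.factorization 2 : ℤ) - d.factorization 2 - h.factorization 2))
    (hγ1 : 1 ≤ γ) :
    (∑' v : ℕ, if 0 < v ∧ ∀ q : ℕ, q.Prime → q ∣ v → q ∣ d then
        ∑ α ∈ d.divisors,
          if Nat.lcm (2 ^ ((h * d / α).factorization 2 + 1)) D.natAbs ∣ d * v then
            (moebius α : ℝ) * Nat.gcd (α * v) h / (Nat.totient (d * v) * α * v)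
          else 0
      else 0)
    = (4 : ℝ) ^ (-γ) *
        ((1 / ((d : ℝ) * ∏ p ∈ d.primeFactors, (p : ℝ) ^ (h.factorization p))) *
          ∏ p ∈ d.primeFactors, (p : ℝ) ^ 2 / ((p : ℝ) ^ 2 - 1)) := by
  have hd0 : d ≠ 0 := by omega
  have hh0 : h ≠ 0 := by omega
  set n := D.natAbs with hn_def
  have hn0 : n ≠ 0 := by
    intro h0
    rw [h0] at hγ
    simp only [Nat.factorization_zero, Finsupp.coe_zero, Pi.zero_apply] at hγ
    omega
  have hnd : n ∣ 4 * d := by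
    have := Int.natAbs_dvd_natAbs.2 hDd
    simpa [Int.natAbs_mul] using this
  obtain ⟨c, rfl⟩ : ∃ c : ℕ, γ = c := ⟨γ.toNat, by omega⟩
  have hc : n.factorization 2 = d.factorization 2 + h.factorization 2 + c := by omega
  have hlt : d.factorization 2 + h.factorization 2 < n.factorization 2 := by omega
  set S := d.primeFactors with hS_def
  have hS : ∀ p ∈ S, p.Prime := fun p hp => Nat.prime_of_mem_primeFactors hp
  have h2S : 2 ∈ S := Nat.mem_primeFactors.2 ⟨Nat.prime_two, h2d, hd0⟩
  set H := ∏ p ∈ S, p ^ h.factorization p with hH_def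
  have hHpos : 0 < H := Finset.prod_pos fun p hp => pow_pos (hS p hp).pos _
  have hM : H * 2 ^ c = ∏ p ∈ S, p ^ (h.factorization p + if p = 2 then c else 0) := by
    simp only [pow_add, Finset.prod_mul_distrib, pow_ite, pow_zero, ← hH_def]
    rw [Finset.prod_ite_eq' S 2, if_pos h2S]
  have hMmem : H * 2 ^ c ∈ Nat.factoredNumbers S := by
    rw [hM, Nat.mem_factoredNumbers']
    intro p hp hpd
    obtain ⟨q, hq, hpq⟩ := (hp.prime.dvd_finsetProd_iff _).1 hpd
    rwa [(Nat.prime_dvd_prime_iff_eq hp (hS q hq)).1 (hp.dvd_of_dvd_pow hpq)]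
  have hMiff : ∀ v : ℕ, v ≠ 0 → (H * 2 ^ c ∣ v ↔
      n.factorization 2 ≤ d.factorization 2 + v.factorization 2 ∧ H ∣ v) := by
    intro v hv
    rw [hM, hH_def, prod_primes_pow_dvd_iff hS, prod_primes_pow_dvd_iff hS]
    constructor
    · intro hall
      refine ⟨?_, fun p hp => (pow_dvd_pow p (Nat.le_add_right _ _)).trans (hall p hp)⟩
      have := hall 2 h2S
      rw [if_pos rfl, Nat.prime_two.pow_dvd_iff_le_factorization hv] at this
      omega
    · rintro ⟨hle, hall⟩ p hp
      split_ifs with hp2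
      · subst hp2
        rw [Nat.prime_two.pow_dvd_iff_le_factorization hv]
        omega
      · exact hall p hp
  have hterm : ∀ v : ℕ, (if 0 < v ∧ ∀ q : ℕ, q.Prime → q ∣ v → q ∣ d then
        ∑ α ∈ d.divisors,
          if Nat.lcm (2 ^ ((h * d / α).factorization 2 + 1)) n ∣ d * v then
            (moebius α : ℝ) * Nat.gcd (α * v) h / (Nat.totient (d * v) * α * v)
          else 0
      else 0) = ((H : ℝ) / d) *
        if v ∈ Nat.factoredNumbers S ∧ H * 2 ^ c ∣ v then ((v : ℝ) ^ 2)⁻¹ else 0 := by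
    intro v
    have hmem : (0 < v ∧ ∀ q : ℕ, q.Prime → q ∣ v → q ∣ d) ↔ v ∈ Nat.factoredNumbers S := by
      constructor
      · rintro ⟨-, hq⟩
        exact Nat.mem_factoredNumbers'.2 fun p hp hpv =>
          Nat.mem_primeFactors.2 ⟨hp, hq p hp hpv, hd0⟩
      · intro hv
        exact ⟨Nat.pos_of_ne_zero (Nat.ne_zero_of_mem_factoredNumbers hv), fun q hq hqv =>
          Nat.dvd_of_mem_primeFactors (Nat.mem_factoredNumbers'.1 hv q hq hqv)⟩
    by_cases hv : v ∈ Nat.factoredNumbers S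
    swap
    · rw [if_neg (hmem.not.2 hv), if_neg (fun hand => hv hand.1), mul_zero]
    have hv0 := Nat.ne_zero_of_mem_factoredNumbers hv
    rw [if_pos (hmem.2 hv)]
    have hcond : ∀ α ∈ d.divisors,
        (if Nat.lcm (2 ^ ((h * d / α).factorization 2 + 1)) n ∣ d * v then
            (moebius α : ℝ) * Nat.gcd (α * v) h / (Nat.totient (d * v) * α * v) else 0) =
        if n.factorization 2 ≤ d.factorization 2 + v.factorization 2 then
            ((moebius α : ℝ) * Nat.gcd (α * v) h / α) * (1 / (Nat.totient d * (v : ℝ) ^ 2))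
          else 0 := by
      intro α hα
      rw [totient_mul_of_mem_factoredNumbers hd0 hv]
      refine if_ctx_congr
        (lcm_two_pow_dvd_mul_iff hd0 hh0 hv0 hn0 hnd (Nat.dvd_of_mem_divisors hα) hlt)
        (fun _ => ?_) fun _ => rfl
      rw [div_mul_div_comm, mul_one]
      push_cast
      congr 1
      ring
    rw [Finset.sum_congr rfl hcond]
    simp only [hv, true_and, hMiff v hv0]
    by_cases hle : n.factorization 2 ≤ d.factorization 2 + v.factorization 2
    · simp only [hle, if_true, true_and]
      rw [← Finset.sum_mul, sum_moebius_mul_gcd_div hd0 hh0 hv]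
      split_ifs
      · have ht : (Nat.totient d : ℝ) ≠ 0 := by
          exact_mod_cast (Nat.totient_pos.2 (Nat.pos_of_ne_zero hd0)).ne'
        field_simp
        rfl
      · simp
    · simp [hle]
  rw [tsum_congr hterm, tsum_mul_left, tsum_factoredNumbers_dvd_inv_sq hS hMmem]
  have hHcast : ∏ p ∈ S, (p : ℝ) ^ h.factorization p = (H : ℝ) := by
    rw [hH_def]
    push_cast
    rfl
  have hH0 : (H : ℝ) ≠ 0 := by exact_mod_cast hHpos.ne'
  have hdR : (d : ℝ) ≠ 0 := by exact_mod_cast hd0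
  have h4 : (4 : ℝ) ^ (-(c : ℤ)) = (((2 : ℝ) ^ c) ^ 2)⁻¹ := by
    rw [zpow_neg, zpow_natCast, ← pow_mul, mul_comm c 2, pow_mul]
    norm_num
  rw [hHcast, h4]
  push_cast
  field_simp
end

section
/- Let g = ±g₀^h with g₀ > 1 a rational that is not a perfect power, h ≥ 1 maximal, and let D(g₀) be the discriminant of Q(√g₀). For positive integers k, r with g > 0, the degree [Q(ζ_{kr}, g^{1/k}) : Q] equals φ(kr)·k/(ε·gcd(k,h)), where ε = 2 if n_r | kr and ε = 1 otherwise, with n_r = lcm(2^{ν_2(hr)+1}, D(g₀)). -/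
open Complex

theorem IsCyclotomicExtension.Rat.dvd_of_sq_eq_intCast {F : Type*} [Field F] [NumberField F]
    {m p : ℕ} [NeZero m] [IsCyclotomicExtension {m} ℚ F] (hp : p.Prime) {n : ℤ}
    (hpn : (p : ℤ) ∣ n) (hpn2 : ¬ (p : ℤ) ^ 2 ∣ n) {x : F} (hx : x ^ 2 = n) : p ∣ m := by
  by_contra hm
  have : Fact p.Prime := ⟨hp⟩
  let y : NumberField.RingOfIntegers F :=
    ⟨x, IsIntegral.of_pow two_pos (by rw [hx]; exact isIntegral_algebraMap (x := n))⟩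
  have hy : y ^ 2 = (n : NumberField.RingOfIntegers F) := by
    apply NumberField.RingOfIntegers.ext
    change algebraMap _ F (y ^ 2) = algebraMap _ F (n : NumberField.RingOfIntegers F)
    rw [map_pow, map_intCast]
    exact hx
  have hpm : (Ideal.span {(p : ℤ)}).IsPrime := by
    rw [Ideal.span_singleton_prime (by exact_mod_cast hp.ne_zero)]
    exact Nat.prime_iff_prime_int.mp hp
  obtain ⟨⟨P, hP, hPl⟩⟩ :=
    (Ideal.span {(p : ℤ)}).nonempty_primesOver (S := NumberField.RingOfIntegers F)
  have hmap : (Ideal.span {(p : ℤ)}).map (algebraMap ℤ (NumberField.RingOfIntegers F)) =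
      Ideal.span {(p : NumberField.RingOfIntegers F)} := by
    simp [Ideal.map_span]
  have hne : (Ideal.span {(p : ℤ)}).map (algebraMap ℤ (NumberField.RingOfIntegers F)) ≠ ⊥ := by
    rw [hmap]
    simp [hp.ne_zero]
  have h1 := IsCyclotomicExtension.Rat.ramificationIdx_eq_of_not_dvd p F P hm
  rw [Ideal.IsDedekindDomain.ramificationIdx_eq_multiplicity (Ideal.span {(p : ℤ)}) P hne] at h1
  have hPb : P ≠ ⊥ := Ideal.ne_bot_of_liesOver_of_ne_bot
    (p := Ideal.span {(p : ℤ)}) (by simp [hp.ne_zero]) P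
  have hnot : ¬ P ^ 2 ∣ Ideal.span {(p : NumberField.RingOfIntegers F)} := by
    rw [← hmap]
    intro hd
    have hfin : FiniteMultiplicity P
        ((Ideal.span {(p : ℤ)}).map (algebraMap ℤ (NumberField.RingOfIntegers F))) :=
      FiniteMultiplicity.of_prime_left (Ideal.prime_of_isPrime hPb hP) hne
    have := hfin.le_multiplicity_of_pow_dvd hd
    omega
  obtain ⟨c, rfl⟩ := hpn
  have hc : ¬ (p : ℤ) ∣ c := fun h => hpn2 (by rw [pow_two]; exact mul_dvd_mul_left _ h)
  have hcP : (c : NumberField.RingOfIntegers F) ∉ P := by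
    intro h
    have : c ∈ P.under ℤ := by simpa [Ideal.mem_comap] using h
    rw [← Ideal.over_def P (Ideal.span {(p : ℤ)}), Ideal.mem_span_singleton] at this
    exact hc this
  have hpP : (p : NumberField.RingOfIntegers F) ∈ P := by
    have : (p : ℤ) ∈ P.under ℤ := by
      rw [← Ideal.over_def P (Ideal.span {(p : ℤ)})]
      exact Ideal.mem_span_singleton_self _
    simpa [Ideal.mem_comap] using this
  have hyP : y ∈ P := by
    apply hP.mem_of_pow_mem 2
    rw [hy]
    push_cast
    exact P.mul_mem_right _ hpP
  apply hnot
  have hyI : P ^ 2 ∣ Ideal.span {(p : NumberField.RingOfIntegers F)} *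
      Ideal.span {(c : NumberField.RingOfIntegers F)} := by
    rw [Ideal.span_singleton_mul_span_singleton, Ideal.dvd_span_singleton]
    have := Ideal.pow_mem_pow hyP 2
    rw [hy] at this
    simpa using this
  refine (Ideal.prime_of_isPrime hPb hP).pow_dvd_of_dvd_mul_right 2 ?_ hyI
  rwa [Ideal.dvd_span_singleton]

theorem IsCyclotomicExtension.Rat.two_pow_dvd_of_isPrimitiveRoot {F : Type*} [Field F]
    [NumberField F] {m a : ℕ} [NeZero m] [IsCyclotomicExtension {m} ℚ F] (ha : 2 ≤ a) {ζ : F}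
    (hζ : IsPrimitiveRoot ζ (2 ^ a)) : 2 ^ a ∣ m := by
  have hm : m ≠ 0 := NeZero.ne m
  have key := IsPrimitiveRoot.lcm_totient_le_finrank hζ (IsCyclotomicExtension.zeta_spec m ℚ F)
    (Polynomial.cyclotomic.irreducible_rat (Nat.lcm_pos (by positivity) (NeZero.pos m)))
  rw [IsCyclotomicExtension.Rat.finrank m F] at key
  have hd : m ∣ Nat.lcm (2 ^ a) m := Nat.dvd_lcm_right _ _
  have hpos : 0 < Nat.lcm (2 ^ a) m := Nat.lcm_pos (by positivity) (NeZero.pos m)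
  have heq := le_antisymm (Nat.le_of_dvd (Nat.totient_pos.mpr hpos) (Nat.totient_dvd_of_dvd hd)) key
  rcases Nat.eq_or_eq_of_totient_eq_totient hd heq with h | h
  · rw [h]; exact Nat.dvd_lcm_left _ _
  · have h4 : 2 * 2 ∣ 2 * m := by
      rw [h]
      exact (pow_dvd_pow 2 ha).trans (Nat.dvd_lcm_left _ _)
    have h2 : 2 ∣ m := Nat.dvd_of_mul_dvd_mul_left two_pos h4
    rw [← h, Nat.totient_mul_of_prime_of_dvd Nat.prime_two h2] at heq
    have := Nat.totient_pos.mpr (NeZero.pos m)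
    omega

theorem exists_sq_eq_of_odd_of_dvd {F : Type*} [Field F] [CharZero F] {m : ℕ} [NeZero m] {ζ : F}
    (hζ : IsPrimitiveRoot ζ m) (n : ℕ) (hn : Odd n) (hnm : n ∣ m) :
    ∃ s : ℤ, s.natAbs = n ∧ s % 4 = 1 ∧ ∃ x : F, x ^ 2 = s := by
  induction n using induction_on_primes with
  | zero => simp at hn
  | one => exact ⟨1, by simp, by simp, 1, by simp⟩
  | prime_mul p n hp ih =>
    rw [Nat.odd_mul] at hn
    obtain ⟨s, hs, hs4, x, hx⟩ := ih hn.2 ((Dvd.intro_left _ rfl).trans hnm)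
    suffices ∃ t : ℤ, t.natAbs = p ∧ t % 4 = 1 ∧ ∃ x : F, x ^ 2 = t by
      obtain ⟨t, ht, ht4, y, hy⟩ := this
      refine ⟨t * s, by rw [Int.natAbs_mul, ht, hs], by rw [Int.mul_emod, ht4, hs4]; rfl, y * x, ?_⟩
      rw [mul_pow, hx, hy]; push_cast; rfl
    have : Fact p.Prime := ⟨hp⟩
    have hp2 : p ≠ 2 := by rintro rfl; exact absurd hn.1 (by decide)
    obtain ⟨q, hq⟩ : p ∣ m := (Dvd.intro _ rfl).trans hnm
    have hη : IsPrimitiveRoot (ζ ^ q) p := hζ.pow (NeZero.pos m) (by rw [hq, mul_comm])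
    have hchar : ringChar (ZMod p) ≠ 2 := by rwa [ZMod.ringChar_zmod_n]
    have hψ := AddChar.zmodChar_primitive_of_primitive_root p hη
    have hχ1 : (quadraticChar (ZMod p)).ringHomComp (Int.castRingHom F) ≠ 1 := by
      rw [Ne, MulChar.ringHomComp_eq_one_iff Int.cast_injective]
      exact quadraticChar_ne_one hchar
    have hsq := gaussSum_sq hχ1 ((quadraticChar_isQuadratic (ZMod p)).comp _) hψ
    rw [MulChar.ringHomComp_apply, quadraticChar_neg_one hchar, ZMod.card] at hsq
    refine ⟨ZMod.χ₄ p * p, ?_, ?_, _, hsq.trans (by simp)⟩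
    all_goals
      rcases Nat.odd_mod_four_iff.mp (Nat.odd_iff.mp hn.1) with h | h
    · rw [ZMod.χ₄_nat_one_mod_four h]; simp
    · rw [ZMod.χ₄_nat_three_mod_four h]; simp
    · rw [ZMod.χ₄_nat_one_mod_four h]; omega
    · rw [ZMod.χ₄_nat_three_mod_four h]; omega

/-- The `m`-th cyclotomic field inside `ℂ`. -/
noncomputable abbrev complexCyclotomicField (m : ℕ) : IntermediateField ℚ ℂ :=
  IntermediateField.adjoin ℚ {Complex.exp (2 * Real.pi * Complex.I / m)}

namespace complexCyclotomicField

theorem exp_mem (m : ℕ) : Complex.exp (2 * Real.pi * Complex.I / m) ∈ complexCyclotomicField m :=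
  IntermediateField.mem_adjoin_simple_self _ _

theorem isIntegral_exp (m : ℕ) [NeZero m] :
    IsIntegral ℚ (Complex.exp (2 * Real.pi * Complex.I / m)) :=
  ((Complex.isPrimitiveRoot_exp m (NeZero.ne m)).isIntegral (NeZero.pos m)).tower_top

instance (m : ℕ) [NeZero m] : IsCyclotomicExtension {m} ℚ (complexCyclotomicField m) := by
  change IsCyclotomicExtension {m} ℚ (complexCyclotomicField m).toSubalgebra
  rw [IntermediateField.adjoin_simple_toSubalgebra_of_isAlgebraic (isIntegral_exp m).isAlgebraic]
  exact (Complex.isPrimitiveRoot_exp m (NeZero.ne m)).adjoin_isCyclotomicExtension ℚ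

instance (m : ℕ) [NeZero m] : NumberField (complexCyclotomicField m) :=
  IsCyclotomicExtension.numberField {m} ℚ _

theorem mem_of_pow_eq_one {m : ℕ} [NeZero m] {z : ℂ} (hz : z ^ m = 1) :
    z ∈ complexCyclotomicField m := by
  obtain ⟨i, -, rfl⟩ :=
    (Complex.isPrimitiveRoot_exp m (NeZero.ne m)).eq_pow_of_pow_eq_one hz
  exact pow_mem (exp_mem m) i

theorem mono {m n : ℕ} [NeZero m] [NeZero n] (h : m ∣ n) :
    complexCyclotomicField m ≤ complexCyclotomicField n := by
  rw [IntermediateField.adjoin_simple_le_iff]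
  obtain ⟨c, rfl⟩ := h
  apply mem_of_pow_eq_one
  rw [pow_mul, (Complex.isPrimitiveRoot_exp m (NeZero.ne m)).pow_eq_one, one_pow]

theorem two_pow_dvd {m a : ℕ} [NeZero m] (ha : 2 ≤ a) {z : ℂ} (hz : z ∈ complexCyclotomicField m)
    (h : z ^ 2 ^ (a - 1) = -1) : 2 ^ a ∣ m := by
  have hp : IsPrimitiveRoot z (2 ^ a) := by
    obtain ⟨b, rfl⟩ : ∃ b, a = b + 1 := ⟨a - 1, by omega⟩
    rw [Nat.add_sub_cancel] at h
    have := orderOf_eq_prime_pow (p := 2) (n := b) (x := z) (by rw [h]; norm_num)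
      (by rw [pow_succ, pow_mul, h]; norm_num)
    rw [← this]
    exact IsPrimitiveRoot.orderOf z
  have hp' : IsPrimitiveRoot (⟨z, hz⟩ : complexCyclotomicField m) (2 ^ a) :=
    IsPrimitiveRoot.coe_submonoidClass_iff.mp hp
  exact IsCyclotomicExtension.Rat.two_pow_dvd_of_isPrimitiveRoot ha hp'

theorem natAbs_dvd_of_sq_eq {m : ℕ} [NeZero m] {n : ℤ} (hn : Squarefree n) {x : ℂ}
    (hx : x ∈ complexCyclotomicField m) (h : x ^ 2 = n) : n.natAbs ∣ m := by
  have hsq : Squarefree n.natAbs := Int.squarefree_natAbs.mpr hn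
  rw [← Nat.prod_primeFactors_of_squarefree hsq]
  refine Finset.prod_primes_dvd m (fun p hp => (Nat.prime_of_mem_primeFactors hp).prime) ?_
  intro p hp
  have hpp := Nat.prime_of_mem_primeFactors hp
  refine IsCyclotomicExtension.Rat.dvd_of_sq_eq_intCast (F := complexCyclotomicField m)
    (x := ⟨x, hx⟩) hpp
    (Int.natCast_dvd.mpr (Nat.dvd_of_mem_primeFactors hp)) ?_ (Subtype.ext (by simpa using h))
  intro hd
  have := hn p (by rwa [← pow_two])
  exact (Nat.prime_iff_prime_int.mp hpp).not_isUnit this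

theorem exists_sq_eq {m n : ℕ} [NeZero m] (hn : Odd n) (hnm : n ∣ m) :
    ∃ s : ℤ, s.natAbs = n ∧ s % 4 = 1 ∧ ∃ x ∈ complexCyclotomicField m, x ^ 2 = s := by
  obtain ⟨s, hs, hs4, x, hx⟩ := exists_sq_eq_of_odd_of_dvd
    (IsCyclotomicExtension.zeta_spec m ℚ (complexCyclotomicField m)) n hn hnm
  exact ⟨s, hs, hs4, x, x.2, by simpa using congrArg Subtype.val hx⟩

theorem I_mem {m : ℕ} [NeZero m] (h : 4 ∣ m) : Complex.I ∈ complexCyclotomicField m := by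
  obtain ⟨c, rfl⟩ := h
  exact mem_of_pow_eq_one (by rw [pow_mul, Complex.I_pow_four, one_pow])

theorem exists_sq_eq_two {m : ℕ} [NeZero m] (h : 8 ∣ m) :
    ∃ x ∈ complexCyclotomicField m, x ^ 2 = 2 := by
  have hζ := Complex.isPrimitiveRoot_exp 8 (by norm_num)
  set z := Complex.exp (2 * Real.pi * Complex.I / (8 : ℕ))
  have h4 : z ^ 4 = -1 := by
    have := (hζ.pow (by norm_num) (show 8 = 4 * 2 by norm_num)).eq_neg_one_of_two_right
    exact this
  have hz : z ∈ complexCyclotomicField m := by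
    obtain ⟨c, rfl⟩ := h
    exact mem_of_pow_eq_one (by rw [pow_mul, hζ.pow_eq_one, one_pow])
  refine ⟨z - z ^ 3, sub_mem hz (pow_mem hz 3), ?_⟩
  linear_combination (z ^ 2 - 2) * h4

theorem natAbs_dvd_of_isFundamentalDiscriminant {m : ℕ} [NeZero m] {D : ℤ}
    (hD : IsFundamentalDiscriminant D) {x : ℂ} (hx : x ∈ complexCyclotomicField m)
    (h : x ^ 2 = D) : D.natAbs ∣ m := by
  rcases hD with ⟨-, hD⟩ | ⟨n, rfl, hn, hn4⟩
  · exact natAbs_dvd_of_sq_eq hD hx h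
  have hx' : x / 2 ∈ complexCyclotomicField m := div_mem hx (ofNat_mem _ 2)
  have h' : (x / 2) ^ 2 = n := by rw [div_pow, h]; push_cast; ring
  have hnm := natAbs_dvd_of_sq_eq hn hx' h'
  rw [Int.natAbs_mul]
  rcases hn4 with hn4 | hn4
  · obtain ⟨n, rfl⟩ : (2 : ℤ) ∣ n := by omega
    have hodd : Odd n.natAbs := by rw [Int.natAbs_odd, Int.odd_iff]; omega
    have hn0 : n ≠ 0 := by omega
    have hnm' : n.natAbs ∣ m := (Int.natAbs_dvd_natAbs.mpr (Dvd.intro_left _ rfl)).trans hnm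
    have hL : NeZero (Nat.lcm 4 m) := ⟨Nat.lcm_ne_zero (by norm_num) (NeZero.ne m)⟩
    obtain ⟨s, hs, -, y, hy, hys⟩ := exists_sq_eq (m := Nat.lcm 4 m) hodd
      (hnm'.trans (Nat.dvd_lcm_right _ _))
    have hI := I_mem (Nat.dvd_lcm_left 4 m)
    have hx'' := mono (Nat.dvd_lcm_right 4 m) hx'
    have h8 : 2 ^ 3 ∣ Nat.lcm 4 m := by
      refine two_pow_dvd (z := (1 + Complex.I) * y / (x / 2)) (by norm_num)
        (div_mem (mul_mem (add_mem (one_mem _) hI) hy) hx'') ?_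
      have hsn : (s : ℂ) ^ 2 = n ^ 2 := by
        have : s ^ 2 = n ^ 2 := Int.natAbs_eq_iff_sq_eq.mp hs
        exact_mod_cast this
      have e1 : (1 + Complex.I) ^ 4 = -4 := by
        linear_combination (Complex.I ^ 2 + 4 * Complex.I + 5) * Complex.I_sq
      have hnC : (n : ℂ) ≠ 0 := by exact_mod_cast hn0
      calc ((1 + Complex.I) * y / (x / 2)) ^ 2 ^ (3 - 1)
          = (1 + Complex.I) ^ 4 * (y ^ 2) ^ 2 / ((x / 2) ^ 2) ^ 2 := by norm_num; ring
        _ = -1 := by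
          rw [e1, hys, h', hsn]; push_cast; field_simp; norm_num
    have h8m : 8 ∣ m := by
      have h8' : 2 ^ 3 ∣ Nat.lcm (2 ^ 2) m := h8
      rw [Nat.prime_two.pow_dvd_iff_le_factorization (Nat.lcm_ne_zero (by norm_num) (NeZero.ne m)),
        Nat.factorization_lcm (by norm_num) (NeZero.ne m), Finsupp.sup_apply,
        Nat.prime_two.factorization_pow, Finsupp.single_eq_same] at h8'
      exact (Nat.prime_two.pow_dvd_iff_le_factorization (k := 3) (NeZero.ne m)).mpr
        ((le_sup_iff.mp h8').resolve_left (by norm_num))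
    rw [Int.natAbs_mul, ← mul_assoc]
    exact Nat.Coprime.mul_dvd_of_dvd_of_dvd
      (Nat.Coprime.pow_left 3 (Nat.coprime_two_left.mpr hodd)) h8m hnm'
  · have hodd : Odd n.natAbs := by rw [Int.natAbs_odd, Int.odd_iff]; omega
    have hn0 : n ≠ 0 := by omega
    obtain ⟨s, hs, hs4, y, hy, hys⟩ := exists_sq_eq (m := m) hodd hnm
    obtain rfl : s = -n := by omega
    have h4 : 2 ^ 2 ∣ m := by
      refine two_pow_dvd (z := y / (x / 2)) le_rfl (div_mem hy hx') ?_
      norm_num only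
      rw [div_pow, h', hys]
      have hnC : (n : ℂ) ≠ 0 := by exact_mod_cast hn0
      push_cast
      field_simp
    exact Nat.Coprime.mul_dvd_of_dvd_of_dvd
      (Nat.Coprime.pow_left 2 (Nat.coprime_two_left.mpr hodd)) h4 hnm

theorem exists_sq_eq_of_isFundamentalDiscriminant {m : ℕ} [NeZero m] {D : ℤ}
    (hD : IsFundamentalDiscriminant D) (hDm : D.natAbs ∣ m) :
    ∃ x ∈ complexCyclotomicField m, x ^ 2 = D := by
  rcases hD with ⟨hD4, -⟩ | ⟨n, rfl, -, hn4⟩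
  · obtain ⟨s, hs, hs4, y, hy, hys⟩ := exists_sq_eq
      (by rw [Int.natAbs_odd, Int.odd_iff]; omega) hDm
    obtain rfl : s = D := by omega
    exact ⟨y, hy, hys⟩
  rw [Int.natAbs_mul] at hDm
  have hI : Complex.I ∈ complexCyclotomicField m := I_mem ((Dvd.intro _ rfl).trans hDm)
  suffices ∃ x ∈ complexCyclotomicField m, x ^ 2 = n ∨ x ^ 2 = -n by
    obtain ⟨x, hx, h⟩ := this
    rcases h with h | h
    · exact ⟨2 * x, mul_mem (ofNat_mem _ 2) hx, by push_cast; rw [← h]; ring⟩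
    · refine ⟨2 * (Complex.I * x), mul_mem (ofNat_mem _ 2) (mul_mem hI hx), ?_⟩
      push_cast
      linear_combination 4 * x ^ 2 * Complex.I_sq - 4 * h
  rcases hn4 with hn4 | hn4
  · obtain ⟨n, rfl⟩ : (2 : ℤ) ∣ n := by omega
    rw [Int.natAbs_mul, ← mul_assoc] at hDm
    obtain ⟨w, hw, hw2⟩ := exists_sq_eq_two ((Dvd.intro _ rfl).trans hDm)
    obtain ⟨s, hs, -, y, hy, hys⟩ := exists_sq_eq (n := n.natAbs)
      (by rw [Int.natAbs_odd, Int.odd_iff]; omega) ((Dvd.intro_left _ rfl).trans hDm)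
    refine ⟨w * y, mul_mem hw hy, ?_⟩
    rw [mul_pow, hw2, hys]
    rcases Int.natAbs_eq_natAbs_iff.mp hs with rfl | rfl
    · left; push_cast; ring
    · right; push_cast; ring
  · obtain ⟨s, hs, -, y, hy, hys⟩ := exists_sq_eq (n := n.natAbs)
      (by rw [Int.natAbs_odd, Int.odd_iff]; omega) ((Dvd.intro_left _ rfl).trans hDm)
    refine ⟨y, hy, ?_⟩
    rw [hys]
    rcases Int.natAbs_eq_natAbs_iff.mp hs with rfl | rfl
    · left; rfl
    · right; push_cast; ring

end complexCyclotomicField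

theorem natDegree_minpoly_radical (F : Type*) {E : Type*} [Field F] [Field E] [IsAlgClosed E]
    [Algebra F E] {a : E} (ha : a ≠ 0) {N : ℕ} (hN : 0 < N)
    (haN : a ^ N ∈ (algebraMap F E).fieldRange)
    (H : ∀ z ∈ (algebraMap F E).fieldRange, ∀ d : ℕ, z ^ N = (a ^ d) ^ N →
      a ^ d ∈ (algebraMap F E).fieldRange) :
    0 < (minpoly F a).natDegree ∧ a ^ (minpoly F a).natDegree ∈ (algebraMap F E).fieldRange ∧
      ∀ j : ℕ, a ^ j ∈ (algebraMap F E).fieldRange → (minpoly F a).natDegree ∣ j := by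
  have hroot {j : ℕ} {c : F} (h : algebraMap F E c = a ^ j) :
      Polynomial.aeval a (Polynomial.X ^ j - Polynomial.C c) = 0 := by
    simp [h]
  obtain ⟨cN, hcN⟩ := haN
  have hint : IsIntegral F a := ⟨_, Polynomial.monic_X_pow_sub_C cN hN.ne', hroot hcN⟩
  have hpos : 0 < (minpoly F a).natDegree := minpoly.natDegree_pos hint
  have hmem : a ^ (minpoly F a).natDegree ∈ (algebraMap F E).fieldRange := by
    set p := (minpoly F a).map (algebraMap F E) with hp
    have hmon : p.Monic := (minpoly.monic hint).map _
    have hspl : p.Splits := IsAlgClosed.splits p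
    have hdeg : p.natDegree = (minpoly F a).natDegree := Polynomial.natDegree_map _
    have hprod := hspl.coeff_zero_eq_prod_roots_of_monic hmon
    rw [hdeg, hp, Polynomial.coeff_map, ← hp] at hprod
    have hz : (-1) ^ (minpoly F a).natDegree * algebraMap F E ((minpoly F a).coeff 0) ∈
        (algebraMap F E).fieldRange :=
      mul_mem (pow_mem (neg_mem (one_mem _)) _) ⟨_, rfl⟩
    refine H _ hz _ ?_
    rw [hprod, ← mul_assoc, ← mul_pow, neg_one_mul, neg_neg, one_pow, one_mul,
      ← Multiset.map_id' p.roots, ← Multiset.prod_map_pow, ← pow_mul, mul_comm, pow_mul]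
    have hconst : p.roots.map (fun z => z ^ N) = Multiset.replicate p.roots.card (a ^ N) := by
      rw [← Multiset.map_const']
      refine Multiset.map_congr rfl fun z hz => ?_
      rw [Polynomial.mem_roots hmon.ne_zero, hp, Polynomial.IsRoot, Polynomial.eval_map_algebraMap]
        at hz
      have := Polynomial.aeval_eq_zero_of_dvd_aeval_eq_zero (minpoly.dvd F a (hroot hcN)) hz
      simpa [hcN, sub_eq_zero] using this
    rw [hconst, Multiset.prod_replicate, ← hspl.natDegree_eq_card_roots, hdeg]
  have hle (j : ℕ) (hj : 0 < j) (h : a ^ j ∈ (algebraMap F E).fieldRange) :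
      (minpoly F a).natDegree ≤ j := by
    obtain ⟨c, hc⟩ := h
    have := Polynomial.natDegree_le_of_dvd (minpoly.dvd F a (hroot hc))
      (Polynomial.X_pow_sub_C_ne_zero hj _)
    rwa [Polynomial.natDegree_X_pow_sub_C] at this
  refine ⟨hpos, hmem, fun j hj => ?_⟩
  by_contra hnd
  have hmod : 0 < j % (minpoly F a).natDegree := Nat.pos_of_ne_zero
    fun h => hnd (Nat.dvd_of_mod_eq_zero h)
  refine absurd (hle _ hmod ?_) (not_le.mpr (Nat.mod_lt j hpos))
  have h1 : a ^ (j % (minpoly F a).natDegree) =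
      a ^ j / (a ^ (minpoly F a).natDegree) ^ (j / (minpoly F a).natDegree) := by
    rw [eq_div_iff (pow_ne_zero _ (pow_ne_zero _ ha)), ← pow_mul, ← pow_add, Nat.mod_add_div]
  rw [h1]
  exact div_mem hj (pow_mem hmem _)

theorem natDegree_minpoly_rat_of_pow_eq {q : ℚ}
    (hq : ¬ ∃ (t : ℚ) (n : ℕ), 2 ≤ n ∧ t ^ n = q) {b : ℝ} (hb : 0 < b) {e : ℕ} (he : 0 < e)
    (hbe : b ^ e = q) : (minpoly ℚ (b : ℂ)).natDegree = e := by
  have hbe' : (b : ℂ) ^ e = q := by exact_mod_cast hbe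
  have hmem : (b : ℂ) ^ e ∈ (algebraMap ℚ ℂ).fieldRange := ⟨q, by simp [hbe']⟩
  obtain ⟨-, ⟨r, hr⟩, h3⟩ := natDegree_minpoly_radical ℚ (by exact_mod_cast hb.ne') he hmem (by
    rintro _ ⟨r, rfl⟩ d hzd
    have hr : (r : ℝ) ^ e = (b ^ d) ^ e := by
      rw [eq_ratCast] at hzd
      exact_mod_cast hzd
    have habs : ((|r| : ℚ) : ℝ) = b ^ d := by
      rw [Rat.cast_abs, ← pow_left_inj₀ (abs_nonneg _) (pow_pos hb d).le he.ne', ← abs_pow, hr]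
      exact abs_of_pos (by positivity)
    exact ⟨|r|, by rw [eq_ratCast, ← Complex.ofReal_ratCast, habs, Complex.ofReal_pow]⟩)
  obtain ⟨f, hf⟩ := h3 e hmem
  have hf1 : ¬ 2 ≤ f := fun hf2 => hq ⟨r, f, hf2, by
    have : (r : ℂ) ^ f = q := by rw [← hbe', hf, pow_mul, ← hr, eq_ratCast]
    exact_mod_cast this⟩
  have : f ≠ 0 := by rintro rfl; omega
  obtain rfl : f = 1 := by omega
  omega

theorem apply_eq_self_of_mem_rootSet_minpoly {k E : Type*} [Field k] [Field E] [Algebra k E]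
    (K : IntermediateField k E) [IsAbelianGalois k K] (c : E →ₐ[k] E) {x : E} (hx : x ∈ K)
    (hc : c x = x) {z : E} (hz : z ∈ (minpoly k x).rootSet E) : c z = z := by
  have hle : IntermediateField.adjoin k {x} ≤ K :=
    IntermediateField.adjoin_simple_le_iff.mpr hx
  have : IsAbelianGalois k (IntermediateField.adjoin k {x}) :=
    IsAbelianGalois.of_algHom (IntermediateField.inclusion hle)
  have hspl := Normal.splits (F := k) (K := IntermediateField.adjoin k {x}) inferInstance
    (IntermediateField.AdjoinSimple.gen k x)
  rw [IntermediateField.minpoly_gen] at hspl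
  have hzL : z ∈ IntermediateField.adjoin k {x} :=
    (IntermediateField.splits_iff_mem (by
      have := hspl.map (algebraMap _ E)
      rwa [Polynomial.map_map, ← IsScalarTower.algebraMap_eq] at this)).mp hspl z hz
  clear hz
  induction hzL using IntermediateField.adjoin_induction with
  | mem y hy => rw [Set.mem_singleton_iff.mp hy, hc]
  | algebraMap y => exact c.commutes y
  | add _ _ _ _ h1 h2 => rw [map_add, h1, h2]
  | inv _ _ h => rw [map_inv₀, h]
  | mul _ _ _ _ h1 h2 => rw [map_mul, h1, h2]

theorem complexCyclotomicField.natDegree_minpoly_le_two {m : ℕ} [NeZero m] {b : ℝ} {q : ℚ} {e : ℕ}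
    (he : 0 < e) (hbe : b ^ e = q) (hbK : (b : ℂ) ∈ complexCyclotomicField m) :
    (minpoly ℚ (b : ℂ)).natDegree ≤ 2 := by
  have hbe' : (b : ℂ) ^ e = q := by exact_mod_cast hbe
  have hint : IsIntegral ℚ (b : ℂ) := IsIntegral.of_pow he (by
      rw [hbe']; exact isIntegral_algebraMap (x := q))
  have : @IsAbelianGalois ℚ (complexCyclotomicField m) _ _
      (complexCyclotomicField m).algebra' := by
    convert IsCyclotomicExtension.isAbelianGalois {m} ℚ (complexCyclotomicField m)
    exact Subsingleton.elim _ _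
  have hroots : (minpoly ℚ (b : ℂ)).rootSet ℂ ⊆ ({(b : ℂ), -(b : ℂ)} : Set ℂ) := by
    intro z hz
    obtain ⟨r, rfl⟩ := Complex.conj_eq_iff_real.mp (apply_eq_self_of_mem_rootSet_minpoly
      (complexCyclotomicField m)
      (Complex.conjAe.toAlgHom.restrictScalars ℚ) hbK (Complex.conj_ofReal b) hz)
    have hdvd : minpoly ℚ (b : ℂ) ∣ Polynomial.X ^ e - Polynomial.C q :=
      minpoly.dvd _ _ (by simp [hbe'])
    have hr := Polynomial.aeval_eq_zero_of_dvd_aeval_eq_zero hdvd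
      (Polynomial.aeval_eq_zero_of_mem_rootSet hz)
    have hre : r ^ e = b ^ e := by
      rw [hbe]
      simp only [map_sub, map_pow, Polynomial.aeval_X, Polynomial.aeval_C, eq_ratCast,
        sub_eq_zero] at hr
      exact_mod_cast hr
    have habs : |r| = |b| := by
      rw [← pow_left_inj₀ (abs_nonneg _) (abs_nonneg _) he.ne', ← abs_pow, ← abs_pow, hre]
    rcases abs_eq_abs.mp habs with rfl | rfl
    · simp
    · simp
  have hsep : (minpoly ℚ (b : ℂ)).Separable := (minpoly.irreducible hint).separable
  rw [← Polynomial.card_rootSet_eq_natDegree hsep (IsAlgClosed.splits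
      ((minpoly ℚ (b : ℂ)).map (algebraMap ℚ ℂ))), ← Nat.card_eq_fintype_card, Nat.card_coe_set_eq]
  exact (Set.ncard_le_ncard hroots).trans ((Set.ncard_insert_le _ _).trans (by simp))

theorem complexCyclotomicField.finrank_adjoin (m : ℕ) [NeZero m] {a : ℂ} (ha : IsIntegral ℚ a) :
    Module.finrank ℚ (IntermediateField.adjoin ℚ
      ({Complex.exp (2 * Real.pi * Complex.I / m), a} : Set ℂ)) =
      m.totient * (minpoly (complexCyclotomicField m) a).natDegree := by
  rw [Set.insert_eq, ← IntermediateField.adjoin_adjoin_left,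
    ← IntermediateField.adjoin.finrank (K := complexCyclotomicField m) ha.tower_top,
    ← IsCyclotomicExtension.Rat.finrank m (complexCyclotomicField m)]
  exact (Module.finrank_mul_finrank ℚ (complexCyclotomicField m)
    (IntermediateField.adjoin (complexCyclotomicField m) {a})).symm

theorem complexCyclotomicField.natDegree_minpoly_mul_eq {m : ℕ} [NeZero m] {q : ℚ}
    (hq : ¬ ∃ (t : ℚ) (n : ℕ), 2 ≤ n ∧ t ^ n = q) {D : ℤ} (hD : IsFundamentalDiscriminant D)
    {t : ℚ} (ht : t ≠ 0) (hDq : (D : ℚ) = q * t ^ 2) {a : ℝ} (ha : 0 < a) {N : ℕ} (hN : 0 < N)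
    (hNm : N ∣ m) (haN : a ^ N = q) :
    (minpoly (complexCyclotomicField m) (a : ℂ)).natDegree *
      (if 2 ∣ N ∧ D.natAbs ∣ m then 2 else 1) = N := by
  have hrange (z : ℂ) : z ∈ (algebraMap (complexCyclotomicField m) ℂ).fieldRange ↔
      z ∈ complexCyclotomicField m :=
    ⟨fun ⟨w, hw⟩ => hw ▸ w.2, fun hz => ⟨⟨z, hz⟩, rfl⟩⟩
  have ha0 : (a : ℂ) ≠ 0 := by exact_mod_cast ha.ne'
  have hrat (r : ℚ) : (r : ℂ) ∈ complexCyclotomicField m := by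
    simp
  have haNC : (a : ℂ) ^ N = q := by exact_mod_cast haN
  have hNK : (a : ℂ) ^ N ∈ (algebraMap (complexCyclotomicField m) ℂ).fieldRange := by
    rw [hrange, haNC]
    exact hrat q
  obtain ⟨hpos, hmem, hdvd⟩ := natDegree_minpoly_radical (complexCyclotomicField m) ha0 hN hNK (by
    intro z hz d hzd
    have hz0 : z ≠ 0 := by
      rintro rfl
      rw [zero_pow hN.ne'] at hzd
      exact pow_ne_zero _ (pow_ne_zero _ ha0) hzd.symm
    have h1 : (a : ℂ) ^ d / z ∈ complexCyclotomicField m := by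
      obtain ⟨c, rfl⟩ := hNm
      exact mem_of_pow_eq_one (by
        rw [pow_mul, div_pow, hzd, div_self (by positivity), one_pow])
    rw [hrange] at hz ⊢
    simpa [div_mul_cancel₀ _ hz0] using mul_mem h1 hz)
  simp only [hrange] at hmem hdvd hNK
  set n := (minpoly (complexCyclotomicField m) (a : ℂ)).natDegree
  obtain ⟨e, he⟩ := hdvd N hNK
  have he0 : 0 < e := Nat.pos_of_ne_zero (by rintro rfl; omega)
  have hbe : (a ^ n) ^ e = q := by rw [← pow_mul, ← he, haN]
  have hbK : ((a ^ n : ℝ) : ℂ) ∈ complexCyclotomicField m := by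
    rw [Complex.ofReal_pow]
    exact hmem
  have he2 : e ≤ 2 := by
    rw [← natDegree_minpoly_rat_of_pow_eq hq (pow_pos ha n) he0 hbe]
    exact natDegree_minpoly_le_two he0 hbe hbK
  have hDC : (D : ℂ) = q * t ^ 2 := by exact_mod_cast hDq
  have key : e = 2 ↔ 2 ∣ N ∧ D.natAbs ∣ m := by
    constructor
    · rintro rfl
      refine ⟨⟨n, by rw [he, mul_comm]⟩, ?_⟩
      refine natAbs_dvd_of_isFundamentalDiscriminant hD (mul_mem hmem (hrat t)) ?_
      rw [hDC, mul_pow, ← pow_mul, ← he, haNC]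
    · rintro ⟨⟨c, hc⟩, hDm⟩
      obtain ⟨x, hxK, hx⟩ := exists_sq_eq_of_isFundamentalDiscriminant hD hDm
      have htC : (t : ℂ) ≠ 0 := by exact_mod_cast ht
      have hsq : ((a : ℂ) ^ c) ^ 2 = (x / t) ^ 2 := by
        rw [div_pow, hx, hDC, mul_div_cancel_right₀ _ (pow_ne_zero 2 htC), ← pow_mul, mul_comm c,
          ← hc, haNC]
      have hacK : (a : ℂ) ^ c ∈ complexCyclotomicField m := by
        rcases sq_eq_sq_iff_eq_or_eq_neg.mp hsq with h | h
        · exact h ▸ div_mem hxK (hrat t)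
        · exact h ▸ neg_mem (div_mem hxK (hrat t))
      obtain ⟨f, rfl⟩ := hdvd c hacK
      have : e = 2 * f := Nat.eq_of_mul_eq_mul_left hpos (by rw [← he, hc]; ring)
      omega
  split_ifs with h
  · rw [he, key.mpr h]
  · have : e ≠ 2 := fun h2 => h (key.mp h2)
    obtain rfl : e = 1 := by omega
    exact he.symm

theorem Nat.two_pow_factorization_mul_succ_dvd_mul_iff {k h r d k' h' : ℕ} (hk : 0 < k)
    (hh : 0 < h) (hr : 0 < r) (hkd : k = k' * d) (hhd : h = h' * d) (hc : Nat.Coprime k' h') :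
    2 ^ ((h * r).factorization 2 + 1) ∣ k * r ↔ 2 ∣ k' := by
  subst hkd hhd
  obtain ⟨hk0, hd0⟩ : k' ≠ 0 ∧ d ≠ 0 := by simpa using hk.ne'
  have hh0 : h' ≠ 0 := by rintro rfl; simp at hh
  rw [Nat.prime_two.pow_dvd_iff_le_factorization (by positivity),
    Nat.factorization_mul hk.ne' hr.ne', Nat.factorization_mul hh.ne' hr.ne',
    Nat.factorization_mul hk0 hd0, Nat.factorization_mul hh0 hd0]
  simp only [Finsupp.add_apply]
  rw [show 2 ∣ k' ↔ 1 ≤ k'.factorization 2 from by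
    rw [← Nat.prime_two.pow_dvd_iff_le_factorization hk0, pow_one]]
  constructor
  · omega
  · intro h1
    have : h'.factorization 2 = 0 := by
      refine Nat.factorization_eq_zero_of_not_dvd fun h2 => ?_
      have h3 : 2 ∣ k' := Nat.dvd_of_factorization_pos (by omega)
      exact absurd (hc ▸ Nat.dvd_gcd h3 h2) (by norm_num)
    omega

theorem IntermediateField.adjoin_pair_pow_of_coprime {F E : Type*} [Field F] [Field E] [Algebra F E]
    (z : E) {a : E} (ha : a ≠ 0) {k h : ℕ} (hc : Nat.Coprime k h)
    (hak : a ^ k ∈ (algebraMap F E).fieldRange) :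
    IntermediateField.adjoin F {z, a ^ h} = IntermediateField.adjoin F {z, a} := by
  apply le_antisymm <;> rw [IntermediateField.adjoin_le_iff, Set.insert_subset_iff,
    Set.singleton_subset_iff]
  · have haK : a ∈ IntermediateField.adjoin F {z, a} :=
      IntermediateField.subset_adjoin _ _ (by simp)
    exact ⟨IntermediateField.subset_adjoin _ _ (by simp), pow_mem haK h⟩
  · have haK : a ^ h ∈ IntermediateField.adjoin F {z, a ^ h} :=
      IntermediateField.subset_adjoin _ _ (by simp)
    have hkK : a ^ k ∈ IntermediateField.adjoin F {z, a ^ h} := by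
      obtain ⟨c, hc⟩ := hak
      exact hc ▸ IntermediateField.algebraMap_mem _ c
    refine ⟨IntermediateField.subset_adjoin _ _ (by simp), ?_⟩
    have h1 : a = (a ^ k) ^ (k.gcdA h) * (a ^ h) ^ (k.gcdB h) := by
      have := Nat.gcd_eq_gcd_ab k h
      rw [hc.gcd_eq_one] at this
      rw [← zpow_natCast a k, ← zpow_natCast a h, ← zpow_mul, ← zpow_mul, ← zpow_add₀ ha, ← this]
      simp
    have := mul_mem (zpow_mem hkK (k.gcdA h)) (zpow_mem haK (k.gcdB h))
    rwa [← h1] at this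

theorem kummer_degree (g g₀ : ℚ) (h : ℕ) (hh : 1 ≤ h)
    (hg₀ : 1 < g₀)
    (hg₀pow : ¬ ∃ (q : ℚ) (n : ℕ), 2 ≤ n ∧ q ^ n = g₀)
    (hgh : g = g₀ ^ h)
    (D : ℤ) (hD : IsFundamentalDiscriminant D)
    -- `D` is the discriminant of `ℚ(√g₀)`: `D/g₀` is a nonzero rational square
    (hDg : ∃ t : ℚ, t ≠ 0 ∧ (D : ℚ) = g₀ * t ^ 2)
    (k r : ℕ) (hk : 0 < k) (hr : 0 < r)
    (nr : ℕ) (hnr : nr = Nat.lcm (2 ^ ((h * r).factorization 2 + 1)) D.natAbs)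
    (ε : ℕ) (hε : ε = if nr ∣ k * r then 2 else 1) :
    (Module.finrank ℚ (IntermediateField.adjoin ℚ
        ({Complex.exp (2 * Real.pi * Complex.I / (k * r)),
          (g : ℂ) ^ ((k : ℂ)⁻¹)} : Set ℂ)) : ℚ)
      = (Nat.totient (k * r) : ℚ) * k / (ε * Nat.gcd k h) := by
  obtain ⟨t, ht, hDt⟩ := hDg
  have : NeZero (k * r) := ⟨by positivity⟩
  obtain ⟨k', h', hc, hk', hh'⟩ := Nat.exists_coprime k h
  have hk'0 : 0 < k' := Nat.pos_of_ne_zero fun h0 => by rw [h0, zero_mul] at hk'; omega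
  have hg₀R : (0 : ℝ) < g₀ := by exact_mod_cast one_pos.trans hg₀
  obtain ⟨a, ha, hak⟩ : ∃ a : ℝ, 0 < a ∧ a ^ k' = g₀ :=
    ⟨(g₀ : ℝ) ^ ((k' : ℝ)⁻¹), Real.rpow_pos_of_pos hg₀R _,
      Real.rpow_inv_natCast_pow hg₀R.le hk'0.ne'⟩
  have hakC : (a : ℂ) ^ k' = g₀ := by exact_mod_cast hak
  have hroot : (g : ℂ) ^ ((k : ℂ)⁻¹) = (a : ℂ) ^ h' := by
    have hg : (g : ℝ) = (a ^ h') ^ k := by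
      rw [hgh, Rat.cast_pow, ← hak, ← pow_mul, ← pow_mul]
      congr 1
      conv_lhs => rw [hh']
      conv_rhs => rw [hk']
      ring
    rw [← Complex.ofReal_ratCast, hg, ← Complex.ofReal_natCast, ← Complex.ofReal_inv,
      ← Complex.ofReal_cpow (by positivity), Real.pow_rpow_inv_natCast (by positivity) hk.ne',
      Complex.ofReal_pow]
  have hint : IsIntegral ℚ (a : ℂ) :=
    IsIntegral.of_pow hk'0 (by rw [hakC]; exact isIntegral_algebraMap (x := g₀))
  have hdeg := complexCyclotomicField.natDegree_minpoly_mul_eq (m := k * r) hg₀pow hD ht hDt ha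
    hk'0 (Dvd.dvd.mul_right ⟨_, hk'⟩ r) hak
  have hε' : ε = if 2 ∣ k' ∧ D.natAbs ∣ k * r then 2 else 1 := by
    simp only [hε, hnr, Nat.lcm_dvd_iff,
      Nat.two_pow_factorization_mul_succ_dvd_mul_iff hk hh hr hk' hh' hc]
  rw [← hε'] at hdeg
  have hε0 : (ε : ℚ) ≠ 0 := by
    rw [hε]
    split_ifs <;> norm_num
  have hd0 : ((k.gcd h : ℕ) : ℚ) ≠ 0 := by exact_mod_cast (Nat.gcd_pos_of_pos_left h hk).ne'
  have hfin := complexCyclotomicField.finrank_adjoin (k * r) hint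
  rw [← IntermediateField.adjoin_pair_pow_of_coprime _ (by exact_mod_cast ha.ne') hc
    ⟨g₀, by simp [hakC]⟩, ← hroot, Nat.cast_mul] at hfin
  rw [hfin, eq_div_iff (mul_ne_zero hε0 hd0)]
  have hkQ : (k : ℚ) = (minpoly (complexCyclotomicField (k * r)) (a : ℂ)).natDegree * ε *
      (k.gcd h : ℕ) := by
    exact_mod_cast hdeg.symm ▸ hk'
  push_cast
  linear_combination (-((k * r).totient : ℚ)) * hkQ
end
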